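/- Let ℒ be a subspace lattice on a complex Banach space X and 𝒜 = alg ℒ. If there exists a nontrivial idempotent P ∈ 𝒜 such that ran(P) ∈ ℒ and P B(X)(I − P) ⊆ 𝒜, then every C ∈ 𝒜 is a Jordan higher all-derivable point: every sequence {d_i}_{i∈ℕ} of linear maps on 𝒜 with d₀ = id_𝒜 that is Jordan higher derivable at C is a Jordan higher derivation. -/

import Mathlib

set_option synthInstance.maxHeartbeats 1000000
set_option maxHeartbeats 1000000

/-- The algebra `alg ℒ` of all bounded operators leaving every member of `ℒ` invariant. -/
def algLat {X : Type*} [NormedAddCommGroup X] [NormedSpace ℂ X]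
    (ℒ : Set (Submodule ℂ X)) : Subalgebra ℂ (X →L[ℂ] X) where
  carrier := {T | ∀ K ∈ ℒ, ∀ x ∈ K, T x ∈ K}
  mul_mem' := by
    intro T S hT hS K hK x hx
    exact hT K hK _ (hS K hK x hx)
  add_mem' := by
    intro T S hT hS K hK x hx
    exact K.add_mem (hT K hK x hx) (hS K hK x hx)
  one_mem' := by
    intro K hK x hx
    exact hx
  algebraMap_mem' := by
    intro c K hK x hx
    show (algebraMap ℂ (X →L[ℂ] X) c) x ∈ K
    rw [Algebra.algebraMap_eq_smul_one]
    exact K.smul_mem c hx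
  zero_mem' := by
    intro K hK x hx
    exact K.zero_mem

section JordanDefect

variable {K R : Type*} [Field K] [Ring R] [Algebra K R]

/-- The Jordan product `a * b + b * a` as a bilinear map. -/
def jordanMul (K R : Type*) [Field K] [Ring R] [Algebra K R] : R →ₗ[K] R →ₗ[K] R :=
  LinearMap.mul K R + (LinearMap.mul K R).flip

theorem jordanMul_apply (a b : R) : jordanMul K R a b = a * b + b * a := rfl

theorem jordanMul_comm (a b : R) : jordanMul K R a b = jordanMul K R b a := by
  simp only [jordanMul_apply, add_comm]

/-- The failure of a linear map to be a Jordan derivation, as a bilinear map. -/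
def jordanDefect (δ : R →ₗ[K] R) : R →ₗ[K] R →ₗ[K] R :=
  (jordanMul K R).compr₂ δ - jordanMul K R ∘ₗ δ - (jordanMul K R).compl₂ δ

theorem jordanDefect_eq (δ : R →ₗ[K] R) (a b : R) :
    jordanDefect δ a b =
      δ (jordanMul K R a b) - jordanMul K R (δ a) b - jordanMul K R a (δ b) := rfl

theorem jordanDefect_apply (δ : R →ₗ[K] R) (a b : R) :
    jordanDefect δ a b =
      δ (a * b) + δ (b * a) - (δ a * b + b * δ a) - (a * δ b + δ b * a) := by
  rw [jordanDefect_eq]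
  simp only [jordanMul_apply, map_add]

theorem jordanDefect_comm (δ : R →ₗ[K] R) (a b : R) :
    jordanDefect δ a b = jordanDefect δ b a := by
  rw [jordanDefect_apply, jordanDefect_apply]
  abel

/-- The inner derivation `x ↦ x * g - g * x`. -/
def innerDer (K : Type*) {R : Type*} [Field K] [Ring R] [Algebra K R] (g : R) : R →ₗ[K] R :=
  (LinearMap.mul K R).flip g - LinearMap.mul K R g

theorem innerDer_apply (g x : R) : innerDer K g x = x * g - g * x := rfl

theorem jordanDefect_sub_innerDer (δ : R →ₗ[K] R) (g : R) :
    jordanDefect (δ - innerDer K g) = jordanDefect δ := by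
  ext a b
  simp only [jordanDefect_apply, LinearMap.sub_apply, innerDer_apply, mul_sub, sub_mul, mul_assoc]
  abel

end JordanDefect

section HigherDerivation

open Finset

variable {K R : Type*} [Field K] [Ring R] [Algebra K R]

theorem sum_antidiagonal_assoc {M : Type*} [AddCommMonoid M] (n : ℕ) (f : ℕ → ℕ → ℕ → M) :
    ∑ p ∈ antidiagonal n, ∑ q ∈ antidiagonal p.2, f p.1 q.1 q.2 =
      ∑ p ∈ antidiagonal n, ∑ q ∈ antidiagonal p.1, f q.1 q.2 p.2 := by
  rw [sum_sigma', sum_sigma']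
  refine sum_nbij' (fun x => ⟨(x.1.1 + x.2.1, x.2.2), (x.1.1, x.2.1)⟩)
    (fun x => ⟨(x.2.1, x.2.2 + x.1.2), (x.2.2, x.1.2)⟩) ?_ ?_ ?_ ?_ ?_ <;>
  · rintro ⟨⟨a, b⟩, ⟨c, e⟩⟩ h
    simp only [mem_sigma, HasAntidiagonal.mem_antidiagonal] at h
    obtain ⟨h₁, h₂⟩ := h
    subst h₂ h₁
    simp [add_assoc]

/-- The sequence `δ` determined by `n d_n = ∑_{k ≤ n} δ_k d_{n-k}`. -/
def higherLogDer (d : ℕ → R →ₗ[K] R) : ℕ → R →ₗ[K] R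
  | n => (n : K) • d n - ∑ k : Fin n, higherLogDer d k ∘ₗ d (n - k)
termination_by n => n
decreasing_by exact k.2

theorem higherLogDer_zero (d : ℕ → R →ₗ[K] R) : higherLogDer d 0 = 0 := by
  rw [higherLogDer]; simp

theorem smul_eq_sum_higherLogDer (d : ℕ → R →ₗ[K] R) (h0 : d 0 = LinearMap.id) (n : ℕ) (a : R) :
    (n : K) • d n a = ∑ p ∈ antidiagonal n, higherLogDer d p.1 (d p.2 a) := by
  rw [Nat.sum_antidiagonal_eq_sum_range_succ_mk, sum_range_succ, Nat.sub_self, h0]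
  conv_rhs => rw [higherLogDer]
  simp only [LinearMap.id_apply, LinearMap.sub_apply, LinearMap.smul_apply, LinearMap.sum_apply,
    LinearMap.comp_apply]
  rw [Fin.sum_univ_eq_sum_range (fun k => higherLogDer d k (d (n - k) a))]
  abel

theorem smul_higher_defect (d : ℕ → R →ₗ[K] R) (h0 : d 0 = LinearMap.id) (n : ℕ)
    (hd : ∀ m < n, ∀ a b, d m (jordanMul K R a b) =
      ∑ p ∈ antidiagonal m, jordanMul K R (d p.1 a) (d p.2 b))
    (hδ : ∀ k < n, ∀ a b, jordanDefect (higherLogDer d k) a b = 0) (a b : R) :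
    (n : K) • (d n (jordanMul K R a b) -
      ∑ p ∈ antidiagonal n, jordanMul K R (d p.1 a) (d p.2 b)) =
    jordanDefect (higherLogDer d n) a b := by
  have hleft : ∀ a b : R, ∑ p ∈ antidiagonal n, ∑ q ∈ antidiagonal p.2,
      jordanMul K R (higherLogDer d p.1 (d q.1 a)) (d q.2 b) =
      ∑ p ∈ antidiagonal n, (p.1 : K) • jordanMul K R (d p.1 a) (d p.2 b) := by
    intro a b
    rw [sum_antidiagonal_assoc (f := fun k i j =>
      jordanMul K R (higherLogDer d k (d i a)) (d j b))]
    refine sum_congr rfl fun p _ => ?_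
    rw [← LinearMap.smul_apply, ← map_smul, smul_eq_sum_higherLogDer d h0, map_sum,
      LinearMap.sum_apply]
  have hright : ∑ p ∈ antidiagonal n, ∑ q ∈ antidiagonal p.2,
      jordanMul K R (d q.1 a) (higherLogDer d p.1 (d q.2 b)) =
      ∑ p ∈ antidiagonal n, (p.2 : K) • jordanMul K R (d p.1 a) (d p.2 b) := by
    rw [← Nat.sum_antidiagonal_swap (n := n)
      (f := fun p => (p.2 : K) • jordanMul K R (d p.1 a) (d p.2 b))]
    simp only [Prod.fst_swap, Prod.snd_swap]
    simp_rw [jordanMul_comm (K := K) (d _ a) _]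
    rw [← hleft b a]
    refine sum_congr rfl fun p _ => ?_
    rw [← Nat.sum_antidiagonal_swap]
    rfl
  have hterm : ∀ p ∈ antidiagonal n, higherLogDer d p.1 (d p.2 (jordanMul K R a b)) =
      ∑ q ∈ antidiagonal p.2, jordanMul K R (higherLogDer d p.1 (d q.1 a)) (d q.2 b) +
      ∑ q ∈ antidiagonal p.2, jordanMul K R (d q.1 a) (higherLogDer d p.1 (d q.2 b)) +
      if p = (n, 0) then jordanDefect (higherLogDer d n) a b else 0 := by
    rintro ⟨k, m⟩ hp
    rw [HasAntidiagonal.mem_antidiagonal] at hp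
    simp only at hp ⊢
    by_cases hkn : k = n
    · obtain rfl : m = 0 := by omega
      subst hkn
      simp only [h0, Nat.antidiagonal_zero, sum_singleton, if_true, LinearMap.id_apply,
        jordanDefect_eq]
      abel
    · rw [if_neg (by simp [hkn]), add_zero]
      rcases Nat.eq_zero_or_pos k with rfl | hk
      · simp [higherLogDer_zero]
      · rw [hd m (by omega), map_sum, ← sum_add_distrib]
        refine sum_congr rfl fun q _ => ?_
        have := hδ k (by omega) (d q.1 a) (d q.2 b)
        rwa [jordanDefect_eq, sub_sub, sub_eq_zero] at this
  rw [smul_sub, smul_eq_sum_higherLogDer d h0, sum_congr rfl hterm, sum_add_distrib,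
    sum_add_distrib, hleft, hright, ← sum_add_distrib, sum_ite_eq', if_pos (by simp), smul_sum,
    add_sub_right_comm, add_eq_right, sub_eq_zero]
  refine sum_congr rfl fun p hp => ?_
  rw [← add_smul, ← Nat.cast_add, HasAntidiagonal.mem_antidiagonal.1 hp]

theorem sum_range_eq_sum_jordanMul (d : ℕ → R →ₗ[K] R) (n : ℕ) (a b : R) :
    ∑ i ∈ range (n + 1), (d i a * d (n - i) b + d i b * d (n - i) a) =
      ∑ p ∈ antidiagonal n, jordanMul K R (d p.1 a) (d p.2 b) := by
  simp only [jordanMul_apply]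
  rw [← Nat.sum_antidiagonal_eq_sum_range_succ (fun i j => d i a * d j b + d i b * d j a),
    sum_add_distrib, sum_add_distrib, ← Nat.sum_antidiagonal_swap (n := n)
      (f := fun p => d p.2 b * d p.1 a)]
  rfl

/-- If Jordan derivability at `C` always forces a linear map to be a Jordan derivation, then
the same holds for sequences of linear maps and Jordan higher derivations. -/
theorem higher_of_jordanDefect [CharZero K] (C : R)
    (H : ∀ δ : R →ₗ[K] R, (∀ a b, a * b = C → jordanDefect δ a b = 0) →
      ∀ a b, jordanDefect δ a b = 0)
    (d : ℕ → R →ₗ[K] R) (h0 : d 0 = LinearMap.id)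
    (hC : ∀ n a b, a * b = C → d n (jordanMul K R a b) =
      ∑ p ∈ antidiagonal n, jordanMul K R (d p.1 a) (d p.2 b)) (n : ℕ) :
    (∀ a b, d n (jordanMul K R a b) =
      ∑ p ∈ antidiagonal n, jordanMul K R (d p.1 a) (d p.2 b)) ∧
    ∀ a b, jordanDefect (higherLogDer d n) a b = 0 := by
  induction n using Nat.strong_induction_on with
  | _ n ih =>
    have key := smul_higher_defect d h0 n (fun m hm => (ih m hm).1) (fun m hm => (ih m hm).2)
    have hδ : ∀ a b, jordanDefect (higherLogDer d n) a b = 0 :=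
      H _ fun a b hab => by rw [← key, hC n a b hab, sub_self, smul_zero]
    refine ⟨fun a b => ?_, hδ⟩
    rcases Nat.eq_zero_or_pos n with rfl | hn
    · simp [h0]
    · have := key a b
      rw [hδ, smul_eq_zero, sub_eq_zero] at this
      exact this.resolve_left (by exact_mod_cast hn.ne')

end HigherDerivation

section Triangular

variable {K R : Type*} [Field K] [Ring R] [Algebra K R]

/-- Complementary idempotents `P`, `Q` for which the Peirce corner `Q R P` vanishes. -/
structure IsTriangularPair {R : Type*} [Ring R] (P Q : R) : Prop where
  add_eq_one : P + Q = 1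
  left_idem : P * P = P
  lower_eq_zero : ∀ r : R, Q * r * P = 0

/-- The Peirce corner `P R Q`. -/
def peirceCorner (K : Type*) {R : Type*} [Field K] [Ring R] [Algebra K R] (P Q : R) :
    Submodule K R :=
  LinearMap.eqLocus (LinearMap.mulLeft K P) LinearMap.id ⊓
    LinearMap.eqLocus (LinearMap.mulRight K Q) LinearMap.id

theorem mem_peirceCorner {P Q a : R} : a ∈ peirceCorner K P Q ↔ P * a = a ∧ a * Q = a := Iff.rfl

namespace IsTriangularPair

variable {P Q : R}

theorem right_eq (h : IsTriangularPair P Q) : Q = 1 - P := eq_sub_of_add_eq' h.add_eq_one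

theorem right_idem (h : IsTriangularPair P Q) : Q * Q = Q := by
  rw [h.right_eq, mul_sub, sub_mul, sub_mul, h.left_idem]; simp

theorem left_mul_right (h : IsTriangularPair P Q) : P * Q = 0 := by
  rw [h.right_eq, mul_sub, h.left_idem]; simp

theorem right_mul_left (h : IsTriangularPair P Q) : Q * P = 0 := by
  rw [h.right_eq, sub_mul, h.left_idem]; simp

theorem decomp (h : IsTriangularPair P Q) (x : R) : x = P * x * P + P * x * Q + Q * x * Q := by
  have hx : x = (P + Q) * x * (P + Q) := by rw [h.add_eq_one, one_mul, mul_one]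
  conv_lhs => rw [hx]
  rw [mul_add, add_mul, add_mul, add_mul, h.lower_eq_zero, add_zero, add_assoc]

end IsTriangularPair

theorem mul_eq_zero_of_corner {e e' f f' a b : R} (ha : a ∈ peirceCorner K e e')
    (hb : b ∈ peirceCorner K f' f) (hef : e' * f' = 0) : a * b = 0 := by
  rw [← (mem_peirceCorner.1 ha).2, ← (mem_peirceCorner.1 hb).1, mul_assoc, ← mul_assoc e', hef, zero_mul, mul_zero]

theorem mul_mem_peirceCorner {e f g a b : R} (ha : a ∈ peirceCorner K e f)
    (hb : b ∈ peirceCorner K f g) : a * b ∈ peirceCorner K e g := by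
  rw [mem_peirceCorner] at *
  exact ⟨by rw [← mul_assoc, ha.1], by rw [mul_assoc, hb.2]⟩

theorem mul_mul_mem_peirceCorner {e f : R} (he : e * e = e) (hf : f * f = f) (x : R) :
    e * x * f ∈ peirceCorner K e f := by
  rw [mem_peirceCorner]
  exact ⟨by rw [← mul_assoc, ← mul_assoc, he], by rw [mul_assoc, hf]⟩

theorem self_mem_peirceCorner {e : R} (he : e * e = e) : e ∈ peirceCorner K e e := ⟨he, he⟩

/-- Extracting coefficients from a bilinear map evaluated on a family of pairs. -/
theorem bilinear_coefficients [CharZero K] (J : R →ₗ[K] R →ₗ[K] R) (U M Z X N V : R)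
    (H : ∀ s t r : K, s ≠ 0 → t ≠ 0 →
      J (s • U + r • M + t⁻¹ • Z) (s⁻¹ • X - (r * t * s⁻¹) • N + t • V) = 0) :
    J U V = 0 ∧ J U N = J M V ∧ J U X + J Z V = 0 := by
  have h1 := H 1 1 0 one_ne_zero one_ne_zero
  have h2 := H 1 (-1) 0 one_ne_zero (by norm_num)
  have h3 := H 1 2 0 one_ne_zero two_ne_zero
  have h4 := H 1 1 1 one_ne_zero one_ne_zero
  have h5 := H 1 1 (-1) one_ne_zero one_ne_zero
  have h6 := H 1 (-1) 1 one_ne_zero (by norm_num)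
  have h7 := H 1 (-1) (-1) one_ne_zero (by norm_num)
  simp only [map_add, map_sub, map_smul, LinearMap.add_apply,
    LinearMap.smul_apply, inv_one, inv_neg, one_mul, mul_one, zero_mul, one_smul, zero_smul, map_zero,
    LinearMap.zero_apply] at h1 h2 h3 h4 h5 h6 h7
  have e0 : J U X + J Z V = 0 := by
    linear_combination (norm := module) (2⁻¹ : K) • h1 + (2⁻¹ : K) • h2
  have e2 : J U V = 0 := by
    linear_combination (norm := module)
      (2 / 3 : K) • h3 - (1 / 2 : K) • h1 - (1 / 6 : K) • h2
  refine ⟨e2, ?_, e0⟩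
  linear_combination (norm := module)
    (-1 / 4 : K) • h4 + (1 / 4 : K) • h5 + (1 / 4 : K) • h6 - (1 / 4 : K) • h7

/-- Consequences of vanishing at all factorizations of `C`. -/
theorem vanishing_of_factorizations [CharZero K] {P Q : R} (h : IsTriangularPair P Q) {C : R}
    (J : R →ₗ[K] R →ₗ[K] R) (hJ : ∀ a b, a * b = C → J a b = 0) {U U' V V' M : R}
    (hU : U ∈ peirceCorner K P P) (hU' : U' ∈ peirceCorner K P P) (hUU : U * U' = P)
    (hV : V ∈ peirceCorner K Q Q) (hV' : V' ∈ peirceCorner K Q Q) (hVV : V' * V = Q)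
    (hM : M ∈ peirceCorner K P Q) :
    J U V = 0 ∧ J U (U' * M * V) = J M V ∧ J U (U' * P * C) + J (Q * C * V') V = 0 := by
  have hPQ := h.left_mul_right
  have hQP := h.right_mul_left
  refine bilinear_coefficients J U M (Q * C * V') (U' * P * C) (U' * M * V) V
    fun s t r hs ht => hJ _ _ ?_
  have e1 : U * (U' * P * C) = P * C := by
    rw [mul_assoc U', ← mul_assoc, hUU, ← mul_assoc, h.left_idem]
  have e2 : U * (U' * M * V) = M * V := by
    rw [mul_assoc U', ← mul_assoc, hUU, ← mul_assoc, (mem_peirceCorner.1 hM).1]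
  have e3 : U * V = 0 := mul_eq_zero_of_corner hU hV hPQ
  have e4 : M * (U' * P * C) = 0 := by
    rw [mul_assoc U', ← mul_assoc, mul_eq_zero_of_corner hM hU' hQP, zero_mul]
  have e5 : M * (U' * M * V) = 0 := by
    rw [mul_assoc U', ← mul_assoc, mul_eq_zero_of_corner hM hU' hQP, zero_mul]
  have e6 : Q * C * V' * (U' * P * C) = 0 := by
    rw [mul_assoc U', ← mul_assoc, mul_assoc (Q * C), mul_eq_zero_of_corner hV' hU' hQP,
      mul_zero, zero_mul]
  have e7 : Q * C * V' * (U' * M * V) = 0 := by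
    rw [mul_assoc U', ← mul_assoc, mul_assoc (Q * C), mul_eq_zero_of_corner hV' hU' hQP,
      mul_zero, zero_mul]
  have e8 : Q * C * V' * V = Q * C := by
    rw [mul_assoc, hVV]
    have := h.lower_eq_zero C
    rw [h.right_eq] at this ⊢
    rw [mul_sub, this]; simp
  simp only [add_mul, mul_add, mul_sub, smul_mul_smul_comm, e1, e2, e3, e4, e5, e6, e7, e8,
    smul_zero]
  rw [mul_inv_cancel₀ hs, inv_mul_cancel₀ ht, show s * (r * t * s⁻¹) = r * t by field_simp]
  simp only [one_smul, add_zero, zero_add]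
  rw [← add_assoc, sub_add_cancel, ← add_mul, h.add_eq_one, one_mul]

theorem exists_inverse_of_isUnit {e a : R} (he : e * e = e) (ha : a ∈ peirceCorner K e e)
    (c : K) (hu : IsUnit (1 - c • a)) :
    ∃ u' ∈ peirceCorner K e e, (e - c • a) * u' = e ∧ u' * (e - c • a) = e := by
  obtain ⟨u, hu⟩ := hu
  have ha' := mem_peirceCorner.1 ha
  have h1 : e - c • a = e * u := by rw [hu, mul_sub, mul_one, mul_smul_comm, ha'.1]
  have h2 : e - c • a = u * e := by rw [hu, sub_mul, one_mul, smul_mul_assoc, ha'.2]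
  have h3 : (e - c • a) * e = e - c • a := by rw [sub_mul, he, smul_mul_assoc, ha'.2]
  have h4 : e * (e - c • a) = e - c • a := by rw [mul_sub, he, mul_smul_comm, ha'.1]
  refine ⟨e * (↑u⁻¹ : R) * e, mul_mul_mem_peirceCorner he he _, ?_, ?_⟩
  · rw [← mul_assoc, ← mul_assoc, h3, h1, mul_assoc e, Units.mul_inv, mul_one, he]
  · rw [mul_assoc, h4, h2, mul_assoc, Units.inv_mul_cancel_left, he]

/-- A linear map on a corner is determined by its values on the invertible elements. -/
theorem eq_of_eq_on_invertible (hinv : ∀ a : R, ∃ c : K, c ≠ 0 ∧ IsUnit (1 - c • a))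
    {e : R} (he : e * e = e) (φ ψ : R →ₗ[K] R)
    (H : ∀ u ∈ peirceCorner K e e, ∀ u' ∈ peirceCorner K e e, u * u' = e → u' * u = e →
      φ u = ψ u) {a : R} (ha : a ∈ peirceCorner K e e) : φ a = ψ a := by
  obtain ⟨c, hc, hu⟩ := hinv a
  obtain ⟨u', hu', h1, h2⟩ := exists_inverse_of_isUnit he ha c hu
  have hee := self_mem_peirceCorner (K := K) he
  have k1 := H _ (sub_mem hee (Submodule.smul_mem _ c ha)) u' hu' h1 h2
  have k2 := H e hee e hee he he
  simp only [map_sub, map_smul] at k1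
  rw [k2, sub_right_inj] at k1
  exact smul_right_injective R hc k1

theorem corner_relations [CharZero K] {P Q : R} (h : IsTriangularPair P Q)
    (hinv : ∀ a : R, ∃ c : K, c ≠ 0 ∧ IsUnit (1 - c • a)) {C : R}
    (J : R →ₗ[K] R →ₗ[K] R) (hJ : ∀ a b, a * b = C → J a b = 0) {a b : R}
    (ha : a ∈ peirceCorner K P P) (hb : b ∈ peirceCorner K Q Q) :
    J a b = 0 ∧ ∀ N ∈ peirceCorner K P Q, J a (N * b) = J (a * N) b := by
  have hPP := h.left_idem
  have hQQ := h.right_idem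
  constructor
  · refine eq_of_eq_on_invertible hinv hPP (J.flip b) 0 (fun u hu u' hu' huu _ => ?_) ha
    refine eq_of_eq_on_invertible hinv hQQ (J u) 0 (fun v hv v' hv' _ hvv => ?_) hb
    exact (vanishing_of_factorizations h J hJ hu hu' huu hv hv' hvv (zero_mem _)).1
  · intro N hN
    refine eq_of_eq_on_invertible hinv hPP (J.flip (N * b)) (J.flip b ∘ₗ LinearMap.mulRight K N)
      (fun u hu u' hu' huu huu' => ?_) ha
    refine eq_of_eq_on_invertible hinv hQQ (J u ∘ₗ LinearMap.mulLeft K N) (J (u * N))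
      (fun v hv v' hv' _ hvv => ?_) hb
    have := (vanishing_of_factorizations h J hJ hu hu' huu hv hv' hvv
      (mul_mem_peirceCorner hu hN)).2.1
    rwa [← mul_assoc u', huu', (mem_peirceCorner.1 hN).1] at this

theorem diagonal_relation [CharZero K] {P Q : R} (h : IsTriangularPair P Q) {C : R}
    (J : R →ₗ[K] R →ₗ[K] R) (hJ : ∀ a b, a * b = C → J a b = 0) :
    J P (P * C) + J (Q * C * Q) Q = 0 := by
  have hPP := self_mem_peirceCorner (K := K) h.left_idem
  have hQQ := self_mem_peirceCorner (K := K) h.right_idem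
  have := (vanishing_of_factorizations h J hJ hPP hPP h.left_idem hQQ hQQ h.right_idem
    (zero_mem _)).2.2
  rwa [h.left_idem] at this

/-- After subtracting an inner derivation, `δ` preserves the diagonal corners. -/
theorem exists_innerDer_normalized [CharZero K] {P Q : R} (h : IsTriangularPair P Q) (δ : R →ₗ[K] R)
    (H : ∀ a ∈ peirceCorner K P P, ∀ b ∈ peirceCorner K Q Q, jordanDefect δ a b = 0) :
    ∃ g : R, (∀ a ∈ peirceCorner K P P, (δ - innerDer K g) a ∈ peirceCorner K P P) ∧
      ∀ b ∈ peirceCorner K Q Q, (δ - innerDer K g) b ∈ peirceCorner K Q Q := by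
  have hPP := h.left_idem
  have hQQ := h.right_idem
  have hPQ := h.left_mul_right
  have hQP := h.right_mul_left
  have hP := self_mem_peirceCorner (K := K) hPP
  have hQ := self_mem_peirceCorner (K := K) hQQ
  have hdecomp : ∀ x : R, x = P * x * P + P * x * Q + Q * x * Q := h.decomp
  have hbase : ∀ a ∈ peirceCorner K P P, ∀ b ∈ peirceCorner K Q Q,
      δ a * b + b * δ a + (a * δ b + δ b * a) = 0 := fun a ha b hb => by
    have := H a ha b hb
    rw [jordanDefect_apply, mul_eq_zero_of_corner ha hb hPQ, mul_eq_zero_of_corner hb ha hQP,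
      map_zero, zero_add, zero_sub, ← neg_add', neg_eq_zero] at this
    exact this
  have two_cancel : ∀ x : R, x + x = 0 → x = 0 := fun x hx => by
    rw [← two_smul K x] at hx
    exact (smul_eq_zero.1 hx).resolve_left two_ne_zero
  have pull : ∀ {x y : R}, x * y = 0 → ∀ z, x * (y * z) = 0 := fun hxy z => by
    rw [← mul_assoc, hxy, zero_mul]
  have hQQ' : ∀ z, Q * (Q * z) = Q * z := fun z => by rw [← mul_assoc, hQQ]
  have hPP' : ∀ z, P * (P * z) = P * z := fun z => by rw [← mul_assoc, hPP]
  have kP := hbase P hP Q hQ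
  have e0 : P * δ Q * Q = -(P * δ P * Q) := by
    have := congrArg (fun x => P * x * Q) kP
    simp only [mul_add, add_mul, mul_assoc, hQQ, hPQ, hPP', pull hPQ, mul_zero, zero_mul,
      add_zero] at this
    rw [eq_neg_iff_add_eq_zero, add_comm, mul_assoc, mul_assoc]
    exact this
  refine ⟨P * δ P * Q, fun a ha => ?_, fun b hb => ?_⟩
  · have ha' := mem_peirceCorner.1 ha
    have haQ := mul_eq_zero_of_corner ha hQ hPQ
    have hQa := mul_eq_zero_of_corner hQ ha hQP
    have k := hbase a ha Q hQ
    have e1 : Q * δ a * Q = 0 := two_cancel _ <| by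
      have := congrArg (fun x => Q * x * Q) k
      simp only [mul_add, add_mul, mul_assoc, hQQ, haQ, hQQ', pull hQa, mul_zero, zero_mul,
        add_zero] at this
      simpa only [mul_assoc] using this
    have e2 : P * δ a * Q = a * (P * δ P * Q) := by
      have := congrArg (fun x => P * x * Q) k
      simp only [mul_add, add_mul, mul_assoc, hQQ, haQ, pull hPQ, mul_zero, zero_mul,
        add_zero] at this
      rw [← neg_eq_iff_eq_neg.2 e0, mul_neg, ← mul_assoc, ← mul_assoc, ha'.2,
        eq_neg_iff_add_eq_zero, mul_assoc, mul_assoc]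
      rw [← mul_assoc P a, ha'.1] at this
      exact this
    have e3 : (δ - innerDer K (P * δ P * Q)) a = P * δ a * P := by
      rw [LinearMap.sub_apply, innerDer_apply, ← e2, mul_assoc (P * δ P), hQa, mul_zero, sub_zero,
        sub_eq_iff_eq_add]
      conv_lhs => rw [hdecomp (δ a), e1, add_zero]
    rw [e3]
    exact mul_mul_mem_peirceCorner hPP hPP _
  · have hb' := mem_peirceCorner.1 hb
    have hbP := mul_eq_zero_of_corner hb hP hQP
    have hPb := mul_eq_zero_of_corner hP hb hPQ
    have k := hbase P hP b hb
    have e1 : P * δ b * P = 0 := two_cancel _ <| by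
      have := congrArg (fun x => P * x * P) k
      simp only [mul_add, add_mul, mul_assoc, hPP, hbP, hPP', pull hPb, mul_zero, zero_mul,
        zero_add] at this
      simpa only [mul_assoc] using this
    have e2 : P * δ b * Q = -(P * δ P * b) := by
      have := congrArg (fun x => P * x * Q) k
      simp only [mul_add, add_mul, mul_assoc, hPP', hPQ, hb'.2, pull hPb, mul_zero, zero_mul,
        add_zero] at this
      rw [eq_neg_iff_add_eq_zero, add_comm, mul_assoc, mul_assoc]
      simpa only [zero_add] using this
    have e3 : (δ - innerDer K (P * δ P * Q)) b = Q * δ b * Q := by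
      rw [LinearMap.sub_apply, innerDer_apply, mul_assoc (P * δ P), hb'.1, mul_assoc P,
        ← mul_assoc b, hbP, zero_mul, zero_sub, sub_neg_eq_add,
        ← eq_sub_iff_add_eq, sub_eq_add_neg, ← e2]
      conv_lhs => rw [hdecomp (δ b), e1, zero_add, add_comm]
    rw [e3]
    exact mul_mul_mem_peirceCorner hQQ hQQ _

/-- Final analysis of a map `δ` that preserves the diagonal corners. -/
theorem jordanDefect_eq_zero_of_normalized [CharZero K] {P Q : R} (h : IsTriangularPair P Q)
    (hL : ∀ a ∈ peirceCorner K P P, (∀ N ∈ peirceCorner K P Q, a * N = 0) → a = 0)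
    (hR : ∀ b ∈ peirceCorner K Q Q, (∀ N ∈ peirceCorner K P Q, N * b = 0) → b = 0)
    (hS : ∀ a ∈ peirceCorner K P P, ∀ b ∈ peirceCorner K Q Q,
      (∀ N ∈ peirceCorner K P Q, a * N = N * b) → ∃ r : K, a = r • P)
    {C : R} (δ : R →ₗ[K] R) (hJ : ∀ a b, a * b = C → jordanDefect δ a b = 0)
    (hrel : ∀ a ∈ peirceCorner K P P, ∀ b ∈ peirceCorner K Q Q, jordanDefect δ a b = 0 ∧
      ∀ N ∈ peirceCorner K P Q, jordanDefect δ a (N * b) = jordanDefect δ (a * N) b)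
    (hδP : ∀ a ∈ peirceCorner K P P, δ a ∈ peirceCorner K P P)
    (hδQ : ∀ b ∈ peirceCorner K Q Q, δ b ∈ peirceCorner K Q Q) (a b : R) :
    jordanDefect δ a b = 0 := by
  have hPP := h.left_idem
  have hQQ := h.right_idem
  have hPQ := h.left_mul_right
  have hQP := h.right_mul_left
  have hP := self_mem_peirceCorner (K := K) hPP
  have hQ := self_mem_peirceCorner (K := K) hQQ
  have hdecomp : ∀ x : R, x = P * x * P + P * x * Q + Q * x * Q := h.decomp
  have two_cancel : ∀ x : R, x + x = 0 → x = 0 := fun x hx => by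
    rw [← two_smul K x] at hx
    exact (smul_eq_zero.1 hx).resolve_left two_ne_zero
  have hNoff : ∀ N ∈ peirceCorner K P Q,
      δ N ∈ peirceCorner K P Q ∧ δ P * N = N * δ Q := fun N hN => by
    have hN' := mem_peirceCorner.1 hN
    have hNP := mul_eq_zero_of_corner hN hP hQP
    have hQN := mul_eq_zero_of_corner hQ hN hQP
    have key := (hrel P hP Q hQ).2 N hN
    rw [hN'.1, hN'.2, jordanDefect_apply, jordanDefect_apply, hN'.1, hN'.2, hNP, hQN,
      mul_eq_zero_of_corner hN (hδP P hP) hQP, mul_eq_zero_of_corner (hδQ Q hQ) hN hQP,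
      map_zero] at key
    have key' : δ P * N + P * δ N + δ N * P = δ N * Q + Q * δ N + N * δ Q := by
      linear_combination (norm := module) (-1 : K) • key
    have pull : ∀ {x y : R}, x * y = 0 → ∀ z, x * (y * z) = 0 := fun hxy z => by
      rw [← mul_assoc, hxy, zero_mul]
    have hQQ' : ∀ z, Q * (Q * z) = Q * z := fun z => by rw [← mul_assoc, hQQ]
    have hPP' : ∀ z, P * (P * z) = P * z := fun z => by rw [← mul_assoc, hPP]
    have hQE := mul_eq_zero_of_corner hQ (hδP P hP) hQP
    have hFP := mul_eq_zero_of_corner (hδQ Q hQ) hP hQP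
    have e1 : P * δ N * P = 0 := two_cancel _ <| by
      have := congrArg (fun x => P * x * P) key'
      simp only [mul_add, add_mul, mul_assoc, hPP, hNP, hPP', pull hPQ, hFP, hQP, mul_zero,
        add_zero, zero_add] at this
      simpa only [mul_assoc] using this
    have e2 : Q * δ N * Q = 0 := two_cancel _ <| by
      have := congrArg (fun x => Q * x * Q) key'
      simp only [mul_add, add_mul, mul_assoc, hQQ, pull hQN, hQQ', pull hQE, pull hQP, hPQ,
        mul_zero, zero_mul, add_zero] at this
      simpa only [mul_assoc] using this.symm
    have e3 : δ N ∈ peirceCorner K P Q := by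
      rw [hdecomp (δ N), e1, e2, zero_add, add_zero]
      exact mul_mul_mem_peirceCorner hPP hQQ _
    refine ⟨e3, ?_⟩
    rw [(mem_peirceCorner.1 e3).1, (mem_peirceCorner.1 e3).2, mul_eq_zero_of_corner e3 hP hQP,
      mul_eq_zero_of_corner hQ e3 hQP] at key'
    linear_combination (norm := module) (1 : K) • key'
  have hoff : ∀ a ∈ peirceCorner K P P, ∀ b ∈ peirceCorner K Q Q, ∀ N ∈ peirceCorner K P Q,
      δ a * (N * b) + a * δ (N * b) = δ (a * N) * b + a * N * δ b := fun a ha b hb N hN => by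
    have key := (hrel a ha b hb).2 N hN
    have hNb := mul_mem_peirceCorner hN hb
    have haN := mul_mem_peirceCorner ha hN
    rw [jordanDefect_apply, jordanDefect_apply, mul_eq_zero_of_corner hNb ha hQP,
      mul_eq_zero_of_corner hb haN hQP, mul_eq_zero_of_corner hNb (hδP a ha) hQP,
      mul_eq_zero_of_corner (hNoff _ hNb).1 ha hQP,
      mul_eq_zero_of_corner hb (hNoff _ haN).1 hQP,
      mul_eq_zero_of_corner (hδQ b hb) haN hQP, ← mul_assoc a N b] at key
    linear_combination (norm := module) (-1 : K) • key
  obtain ⟨r, hr⟩ := hS (δ P) (hδP P hP) (δ Q) (hδQ Q hQ) fun N hN => (hNoff N hN).2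
  have hrN : ∀ N ∈ peirceCorner K P Q, N * δ Q = r • N := fun N hN => by
    rw [← (hNoff N hN).2, hr, smul_mul_assoc, (mem_peirceCorner.1 hN).1]
  have hrQ : δ Q = r • Q := by
    refine sub_eq_zero.1 (hR _ (sub_mem (hδQ Q hQ) (Submodule.smul_mem _ r hQ)) fun N hN => ?_)
    rw [mul_sub, hrN N hN, mul_smul_comm, (mem_peirceCorner.1 hN).2, sub_self]
  have hPN : ∀ N ∈ peirceCorner K P Q, jordanDefect δ P N = -(r • N) := fun N hN => by
    have hδN := (hNoff N hN).1
    rw [jordanDefect_apply, (mem_peirceCorner.1 hN).1, mul_eq_zero_of_corner hN hP hQP,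
      (mem_peirceCorner.1 hδN).1, mul_eq_zero_of_corner hδN hP hQP, hr, smul_mul_assoc,
      mul_smul_comm, (mem_peirceCorner.1 hN).1, mul_eq_zero_of_corner hN hP hQP, map_zero]
    module
  have hzero : δ P = 0 ∧ δ Q = 0 := by
    by_cases hC : C = 0
    · have hrN0 : ∀ N ∈ peirceCorner K P Q, r • N = 0 := fun N hN => by
        have key := hJ Q N (by rw [hC, mul_eq_zero_of_corner hQ hN hQP])
        have hswap := (hrel P hP Q hQ).2 N hN
        rw [(mem_peirceCorner.1 hN).1, (mem_peirceCorner.1 hN).2, hPN N hN,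
          jordanDefect_comm, key, neg_eq_zero] at hswap
        exact hswap
      exact ⟨hL _ (hδP P hP) fun N hN => by rw [(hNoff N hN).2, hrN N hN, hrN0 N hN],
        hR _ (hδQ Q hQ) fun N hN => by rw [hrN N hN, hrN0 N hN]⟩
    · suffices hr0 : r = 0 by rw [hr, hrQ, hr0]; simp
      by_contra hr0
      have diag := diagonal_relation h (jordanDefect δ) hJ
      have hX := mul_mul_mem_peirceCorner (K := K) hPP hPP C
      have hY := mul_mul_mem_peirceCorner (K := K) hPP hQQ C
      have hZ := mul_mul_mem_peirceCorner (K := K) hQQ hQQ C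
      have hPC : P * C = P * C * P + P * C * Q := by rw [← mul_add, h.add_eq_one, mul_one]
      have hPX : jordanDefect δ P (P * C * P) = -((2 * r) • (P * C * P)) := by
        have hX' := mem_peirceCorner.1 hX
        have hδX' := mem_peirceCorner.1 (hδP _ hX)
        rw [jordanDefect_apply, hX'.1, hX'.2, hδX'.1, hδX'.2, hr, smul_mul_assoc, mul_smul_comm,
          hX'.1, hX'.2]
        module
      have hZQ : jordanDefect δ (Q * C * Q) Q = -((2 * r) • (Q * C * Q)) := by
        have hZ' := mem_peirceCorner.1 hZ
        have hδZ' := mem_peirceCorner.1 (hδQ _ hZ)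
        rw [jordanDefect_apply, hZ'.1, hZ'.2, hδZ'.1, hδZ'.2, hrQ, smul_mul_assoc, mul_smul_comm,
          hZ'.1, hZ'.2]
        module
      rw [hPC, map_add, hPX, hPN _ hY, hZQ] at diag
      have hsum : (2 : K) • (P * C * P) + P * C * Q + (2 : K) • (Q * C * Q) = 0 := by
        rw [← smul_eq_zero_iff_right hr0]
        linear_combination (norm := module) (-1 : K) • diag
      have hX0 : P * C * P = 0 := by
        have := congrArg (fun x => x * P) hsum
        simp only [add_mul, smul_mul_assoc, (mem_peirceCorner.1 hX).2,
          mul_eq_zero_of_corner hY hP hQP, mul_eq_zero_of_corner hZ hP hQP, smul_zero, add_zero,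
          zero_mul] at this
        exact (smul_eq_zero.1 this).resolve_left two_ne_zero
      have hZ0 : Q * C * Q = 0 := by
        have := congrArg (fun x => Q * x) hsum
        simp only [mul_add, mul_smul_comm, (mem_peirceCorner.1 hZ).1,
          mul_eq_zero_of_corner hQ hY hQP, mul_eq_zero_of_corner hQ hX hQP, smul_zero, zero_add,
          mul_zero] at this
        exact (smul_eq_zero.1 this).resolve_left two_ne_zero
      rw [hX0, hZ0] at hsum
      apply hC
      rw [hdecomp C, hX0, hZ0]
      simpa using hsum
  obtain ⟨hEP, hEQ⟩ := hzero
  have hLmul : ∀ a ∈ peirceCorner K P P, ∀ N ∈ peirceCorner K P Q,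
      δ (a * N) = δ a * N + a * δ N := fun a ha N hN => by
    have := hoff a ha Q hQ N hN
    have haN := mul_mem_peirceCorner ha hN
    rw [(mem_peirceCorner.1 hN).2, hEQ, mul_zero, add_zero,
      (mem_peirceCorner.1 (hNoff _ haN).1).2] at this
    exact this.symm
  have hRmul : ∀ b ∈ peirceCorner K Q Q, ∀ N ∈ peirceCorner K P Q,
      δ (N * b) = δ N * b + N * δ b := fun b hb N hN => by
    have := hoff P hP b hb N hN
    have hNb := mul_mem_peirceCorner hN hb
    rwa [(mem_peirceCorner.1 hN).1, hEP, zero_mul, zero_add,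
      (mem_peirceCorner.1 (hNoff _ hNb).1).1] at this
  have hPPmul : ∀ a ∈ peirceCorner K P P, ∀ a' ∈ peirceCorner K P P,
      δ (a * a') = δ a * a' + a * δ a' := fun a ha a' ha' => by
    have haa := mul_mem_peirceCorner ha ha'
    refine sub_eq_zero.1 (hL _ (sub_mem (hδP _ haa) (add_mem
      (mul_mem_peirceCorner (hδP a ha) ha') (mul_mem_peirceCorner ha (hδP a' ha'))))
      fun N hN => ?_)
    have e1 := hLmul _ haa N hN
    rw [mul_assoc a a' N, hLmul a ha _ (mul_mem_peirceCorner ha' hN), hLmul a' ha' N hN] at e1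
    rw [sub_mul, sub_eq_iff_eq_add, zero_add, ← sub_eq_iff_eq_add.2 e1]
    simp only [mul_add, add_mul, mul_assoc]
    abel
  have hQQmul : ∀ b ∈ peirceCorner K Q Q, ∀ b' ∈ peirceCorner K Q Q,
      δ (b * b') = δ b * b' + b * δ b' := fun b hb b' hb' => by
    have hbb := mul_mem_peirceCorner hb hb'
    refine sub_eq_zero.1 (hR _ (sub_mem (hδQ _ hbb) (add_mem
      (mul_mem_peirceCorner (hδQ b hb) hb') (mul_mem_peirceCorner hb (hδQ b' hb'))))
      fun N hN => ?_)
    have e1 := hRmul _ hbb N hN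
    rw [← mul_assoc N b b', hRmul b' hb' _ (mul_mem_peirceCorner hN hb), hRmul b hb N hN,
      ← sub_eq_iff_eq_add'] at e1
    rw [mul_sub, sub_eq_iff_eq_add, zero_add, ← e1]
    simp only [mul_add, add_mul, mul_assoc]
    abel
  have jPP : ∀ a ∈ peirceCorner K P P, ∀ a' ∈ peirceCorner K P P, jordanDefect δ a a' = 0 :=
    fun a ha a' ha' => by
      rw [jordanDefect_apply, hPPmul a ha a' ha', hPPmul a' ha' a ha]
      abel
  have jQQ : ∀ b ∈ peirceCorner K Q Q, ∀ b' ∈ peirceCorner K Q Q, jordanDefect δ b b' = 0 :=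
    fun b hb b' hb' => by
      rw [jordanDefect_apply, hQQmul b hb b' hb', hQQmul b' hb' b hb]
      abel
  have jPN : ∀ a ∈ peirceCorner K P P, ∀ N ∈ peirceCorner K P Q, jordanDefect δ a N = 0 :=
    fun a ha N hN => by
      rw [jordanDefect_apply, hLmul a ha N hN, mul_eq_zero_of_corner hN ha hQP,
        mul_eq_zero_of_corner hN (hδP a ha) hQP, mul_eq_zero_of_corner (hNoff N hN).1 ha hQP,
        map_zero]
      abel
  have jNQ : ∀ N ∈ peirceCorner K P Q, ∀ b ∈ peirceCorner K Q Q, jordanDefect δ N b = 0 :=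
    fun N hN b hb => by
      rw [jordanDefect_apply, hRmul b hb N hN, mul_eq_zero_of_corner hb hN hQP,
        mul_eq_zero_of_corner hb (hNoff N hN).1 hQP, mul_eq_zero_of_corner (hδQ b hb) hN hQP,
        map_zero]
      abel
  have jNN : ∀ N ∈ peirceCorner K P Q, ∀ M ∈ peirceCorner K P Q, jordanDefect δ N M = 0 :=
    fun N hN M hM => by
      have hδN := (hNoff N hN).1
      have hδM := (hNoff M hM).1
      rw [jordanDefect_apply, mul_eq_zero_of_corner hN hM hQP, mul_eq_zero_of_corner hM hN hQP,
        mul_eq_zero_of_corner hδN hM hQP, mul_eq_zero_of_corner hM hδN hQP,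
        mul_eq_zero_of_corner hN hδM hQP, mul_eq_zero_of_corner hδM hN hQP, map_zero]
      abel
  have m1 := mul_mul_mem_peirceCorner (K := K) hPP hPP
  have m2 := mul_mul_mem_peirceCorner (K := K) hPP hQQ
  have m3 := mul_mul_mem_peirceCorner (K := K) hQQ hQQ
  rw [hdecomp a, hdecomp b]
  simp only [map_add, LinearMap.add_apply]
  rw [jPP _ (m1 a) _ (m1 b), jPN _ (m1 a) _ (m2 b), (hrel _ (m1 a) _ (m3 b)).1,
    jordanDefect_comm δ _ (P * b * P), jPN _ (m1 b) _ (m2 a), jNN _ (m2 a) _ (m2 b),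
    jNQ _ (m2 a) _ (m3 b), jordanDefect_comm δ _ (P * b * P), (hrel _ (m1 b) _ (m3 a)).1,
    jordanDefect_comm δ _ (P * b * Q), jNQ _ (m2 b) _ (m3 a), jQQ _ (m3 a) _ (m3 b)]
  simp

/-- In a triangular algebra with enough invertible elements and a suitable bimodule `P R Q`,
Jordan derivability at a single element forces a linear map to be a Jordan derivation. -/
theorem jordanDefect_eq_zero_of_derivable_at [CharZero K] {P Q : R} (h : IsTriangularPair P Q)
    (hinv : ∀ a : R, ∃ c : K, c ≠ 0 ∧ IsUnit (1 - c • a))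
    (hL : ∀ a ∈ peirceCorner K P P, (∀ N ∈ peirceCorner K P Q, a * N = 0) → a = 0)
    (hR : ∀ b ∈ peirceCorner K Q Q, (∀ N ∈ peirceCorner K P Q, N * b = 0) → b = 0)
    (hS : ∀ a ∈ peirceCorner K P P, ∀ b ∈ peirceCorner K Q Q,
      (∀ N ∈ peirceCorner K P Q, a * N = N * b) → ∃ r : K, a = r • P)
    (C : R) (δ : R →ₗ[K] R) (hJ : ∀ a b, a * b = C → jordanDefect δ a b = 0) (a b : R) :
    jordanDefect δ a b = 0 := by
  have hrel := fun a (ha : a ∈ peirceCorner K P P) b (hb : b ∈ peirceCorner K Q Q) =>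
    corner_relations h hinv (jordanDefect δ) hJ ha hb
  obtain ⟨g, hg1, hg2⟩ := exists_innerDer_normalized h δ fun a ha b hb => (hrel a ha b hb).1
  rw [← jordanDefect_sub_innerDer δ g] at hJ hrel ⊢
  exact jordanDefect_eq_zero_of_normalized h hL hR hS _ hJ hrel hg1 hg2 a b

end Triangular

section SubspaceLattice

variable {X : Type*} [NormedAddCommGroup X] [NormedSpace ℂ X]

theorem mem_algLat {ℒ : Set (Submodule ℂ X)} {T : X →L[ℂ] X} :
    T ∈ algLat ℒ ↔ ∀ K ∈ ℒ, ∀ x ∈ K, T x ∈ K := Iff.rfl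

theorem isClosed_algLat {ℒ : Set (Submodule ℂ X)} (hcl : ∀ K ∈ ℒ, IsClosed (K : Set X)) :
    IsClosed (algLat ℒ : Set (X →L[ℂ] X)) := by
  have : (algLat ℒ : Set (X →L[ℂ] X)) =
      ⋂ K ∈ ℒ, ⋂ x ∈ K, (fun T : X →L[ℂ] X => T x) ⁻¹' (K : Set X) := by
    ext T
    simp [mem_algLat]
  rw [this]
  exact isClosed_biInter fun K hK => isClosed_biInter fun x _ =>
    (hcl K hK).preimage (ContinuousLinearMap.apply ℂ X x).continuous

theorem exists_isUnit_one_sub_smul {A : Type*} [NormedRing A] [NormedAlgebra ℂ A]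
    [CompleteSpace A] (a : A) : ∃ c : ℂ, c ≠ 0 ∧ IsUnit (1 - c • a) := by
  have hpos : 0 < ‖a‖ + 1 := by positivity
  refine ⟨((‖a‖ + 1)⁻¹ : ℝ), by exact_mod_cast (inv_pos.2 hpos).ne',
    isUnit_one_sub_of_norm_lt_one ?_⟩
  rw [norm_smul, Complex.norm_real, Real.norm_of_nonneg (inv_pos.2 hpos).le,
    inv_mul_lt_iff₀ hpos]
  linarith

/-- The rank-one operators `x ↦ g (Q x) • P x₀` lie in the corner `P (alg ℒ) Q`. -/
theorem exists_rankOne_mem_corner {ℒ : Set (Submodule ℂ X)} {P : X →L[ℂ] X}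
    (hPmem : P ∈ algLat ℒ) (hP : P * P = P)
    (hPBQ : ∀ T : X →L[ℂ] X, P * T * (1 - P) ∈ algLat ℒ) (x : X) (g : X →L[ℂ] ℂ) :
    ∃ N ∈ peirceCorner ℂ (⟨P, hPmem⟩ : algLat ℒ) (1 - ⟨P, hPmem⟩),
      ∀ y, (N : X →L[ℂ] X) y = g (y - P y) • P x := by
  refine ⟨⟨_, hPBQ (g.smulRight x)⟩, ?_, fun y => ?_⟩
  · rw [mem_peirceCorner]
    constructor <;> ext1
    · simp only [MulMemClass.coe_mul, ← mul_assoc, hP]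
    · have hQ : (1 - P) * (1 - P) = 1 - P := by rw [mul_sub, sub_mul, sub_mul, hP]; simp
      simp only [MulMemClass.coe_mul, AddSubgroupClass.coe_sub, OneMemClass.coe_one, mul_assoc, hQ]
  · simp

end SubspaceLattice

/-- let `ℒ` be a subspace lattice on a complex Banach space `X` and
`𝒜 = alg ℒ`. If there is a nontrivial idempotent `P ∈ 𝒜` with `ran(P) ∈ ℒ` and
`P B(X) (I − P) ⊆ 𝒜`, then every `C ∈ 𝒜` is a Jordan higher all-derivable point: every
sequence `{dᵢ}` of linear maps on `𝒜` with `d₀ = id` that is Jordan higher derivable at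
`C` is a Jordan higher derivation. -/
theorem statement16 {X : Type*} [NormedAddCommGroup X] [NormedSpace ℂ X] [CompleteSpace X]
    (ℒ : Set (Submodule ℂ X))
    (hcl : ∀ K ∈ ℒ, IsClosed (K : Set X))
    (hbot : ⊥ ∈ ℒ) (htop : ⊤ ∈ ℒ)
    (hinf : ∀ S ⊆ ℒ, sInf S ∈ ℒ)
    (hsup : ∀ S ⊆ ℒ, (sSup S).topologicalClosure ∈ ℒ)
    (P : X →L[ℂ] X) (hPmem : P ∈ algLat ℒ)
    (hP : P * P = P) (hP0 : P ≠ 0) (hP1 : P ≠ 1)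
    (hran : LinearMap.range (P : X →ₗ[ℂ] X) ∈ ℒ)
    (hPBQ : ∀ T : X →L[ℂ] X, P * T * (1 - P) ∈ algLat ℒ) :
    ∀ C : algLat ℒ, ∀ d : ℕ → ((algLat ℒ) →ₗ[ℂ] (algLat ℒ)), d 0 = LinearMap.id →
      (∀ n : ℕ, ∀ a b : algLat ℒ, a * b = C → d n (a * b + b * a) =
        ∑ i ∈ Finset.range (n + 1), (d i a * d (n - i) b + d i b * d (n - i) a)) →
      (∀ n : ℕ, ∀ a b : algLat ℒ, d n (a * b + b * a) =
        ∑ i ∈ Finset.range (n + 1), (d i a * d (n - i) b + d i b * d (n - i) a)) := by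
  intro C d hd0 hd n a b
  let p : algLat ℒ := ⟨P, hPmem⟩
  have hpp : p * p = p := Subtype.ext hP
  have : CompleteSpace (algLat ℒ) := (isClosed_algLat hcl).completeSpace_coe
  have htri : IsTriangularPair p (1 - p) :=
    { add_eq_one := add_sub_cancel _ _
      left_idem := hpp
      lower_eq_zero := fun r => by
        ext x
        obtain ⟨y, hy⟩ := r.2 _ hran (P x) ⟨x, rfl⟩
        have hPy : P (P y) = P y := congrArg (fun T : X →L[ℂ] X => T y) hP
        have hy' : P y = (r : X →L[ℂ] X) (P x) := hy
        show (r : X →L[ℂ] X) (P x) - P ((r : X →L[ℂ] X) (P x)) = 0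
        rw [← hy', hPy, sub_self] }
  obtain ⟨y, hy⟩ : ∃ y, y - P y ≠ 0 := by
    by_contra! hall
    exact hP1 (ContinuousLinearMap.ext fun y => (sub_eq_zero.1 (hall y)).symm)
  obtain ⟨x₀, hx₀⟩ : ∃ x, P x ≠ 0 := by
    by_contra! hall
    exact hP0 (ContinuousLinearMap.ext hall)
  obtain ⟨g, hg⟩ : ∃ g : X →L[ℂ] ℂ, g (y - P y) = 1 := SeparatingDual.exists_eq_one hy
  have hrank := exists_rankOne_mem_corner hPmem hP hPBQ
  have happly : ∀ {S T : algLat ℒ}, S = T → ∀ z, (S : X →L[ℂ] X) z = (T : X →L[ℂ] X) z :=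
    fun hST z => by rw [hST]
  have H := jordanDefect_eq_zero_of_derivable_at (K := ℂ) htri exists_isUnit_one_sub_smul
    (fun a ha haN => by
      ext x
      obtain ⟨N, hN, hNy⟩ := hrank x g
      have h1 : (a : X →L[ℂ] X) ((N : X →L[ℂ] X) y) = 0 := happly (haN N hN) y
      rw [hNy, hg, one_smul] at h1
      have h2 : (a : X →L[ℂ] X) (P x) = (a : X →L[ℂ] X) x :=
        happly (mem_peirceCorner.1 ha).2 x
      rw [← h2, h1]
      rfl)
    (fun b hb hbN => by
      ext x
      refine SeparatingDual.eq_zero_of_forall_dual_eq_zero (R := ℂ) fun f => ?_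
      obtain ⟨N, hN, hNy⟩ := hrank x₀ f
      have h1 : (N : X →L[ℂ] X) ((b : X →L[ℂ] X) x) = 0 := happly (hbN N hN) x
      have h2 : (b : X →L[ℂ] X) x - P ((b : X →L[ℂ] X) x) = (b : X →L[ℂ] X) x :=
        happly (mem_peirceCorner.1 hb).1 x
      rw [hNy, h2] at h1
      exact (smul_eq_zero.1 h1).resolve_right hx₀)
    (fun a ha b _ hab => by
      refine ⟨g ((b : X →L[ℂ] X) y - P ((b : X →L[ℂ] X) y)), ?_⟩
      ext x
      obtain ⟨N, hN, hNy⟩ := hrank x g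
      have h1 : (a : X →L[ℂ] X) ((N : X →L[ℂ] X) y) = (N : X →L[ℂ] X) ((b : X →L[ℂ] X) y) :=
        happly (hab N hN) y
      have h2 : (a : X →L[ℂ] X) (P x) = (a : X →L[ℂ] X) x :=
        happly (mem_peirceCorner.1 ha).2 x
      rw [hNy, hNy, hg, one_smul, h2] at h1
      exact h1) C
  rw [sum_range_eq_sum_jordanMul]
  refine (higher_of_jordanDefect C H d hd0 (fun m a b hab => ?_) n).1 a b
  rw [← sum_range_eq_sum_jordanMul]
  exact hd m a b hab
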